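/- Let λ ≥ 0 and define h : (0, π) → ℝ by h(t) = ∫_{π/2}ᵗ sin(s)^λ ds. Let T = {(p₁, p₂, p₃) ∈ ℝ³ : pᵢ + pⱼ < π + p_k for every permutation (i,j,k) of (1,2,3) and p₁ + p₂ + p₃ > π}; note that T ⊆ (0, π)³. Then the image of T under the map (p₁, p₂, p₃) ↦ (h(p₁), h(p₂), h(p₃)) is a convex subset of ℝ³. -/

import Mathlib

open Real Set Filter Topology

/-- The primitive of `sin ^ lam` vanishing at `π / 2`. -/
noncomputable def sinPowPrimitive (lam t : ℝ) : ℝ := ∫ s in (π/2)..t, Real.sin s ^ lam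

section Primitive

variable {lam : ℝ}

theorem hasDerivAt_sinPowPrimitive (hlam : 0 ≤ lam) (t : ℝ) :
    HasDerivAt (sinPowPrimitive lam) (Real.sin t ^ lam) t := by
  have hc : Continuous fun s : ℝ => Real.sin s ^ lam :=
    Real.continuous_sin.rpow_const fun _ => Or.inr hlam
  exact intervalIntegral.integral_hasDerivAt_right (hc.intervalIntegrable _ _)
    (hc.stronglyMeasurableAtFilter _ _) hc.continuousAt

theorem continuous_sinPowPrimitive (hlam : 0 ≤ lam) : Continuous (sinPowPrimitive lam) :=
  continuous_iff_continuousAt.2 fun t => (hasDerivAt_sinPowPrimitive hlam t).continuousAt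

theorem strictMonoOn_sinPowPrimitive (hlam : 0 ≤ lam) :
    StrictMonoOn (sinPowPrimitive lam) (Icc 0 π) := by
  refine strictMonoOn_of_deriv_pos (convex_Icc _ _)
    (continuous_sinPowPrimitive hlam).continuousOn fun x hx => ?_
  rw [interior_Icc] at hx
  rw [(hasDerivAt_sinPowPrimitive hlam x).deriv]
  exact Real.rpow_pos_of_pos (Real.sin_pos_of_mem_Ioo hx) _

theorem sinPowPrimitive_pi_sub (lam t : ℝ) :
    sinPowPrimitive lam (π - t) = -sinPowPrimitive lam t := by
  have h := intervalIntegral.integral_comp_sub_left (a := π / 2) (b := t)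
    (fun s => Real.sin s ^ lam) π
  simp only [Real.sin_pi_sub, sub_half] at h
  rw [sinPowPrimitive, sinPowPrimitive, h, intervalIntegral.integral_symm]

theorem mapsTo_sinPowPrimitive (hlam : 0 ≤ lam) :
    MapsTo (sinPowPrimitive lam) (Ioo 0 π)
      (Ioo (sinPowPrimitive lam 0) (sinPowPrimitive lam π)) := by
  intro x hx
  have hm := strictMonoOn_sinPowPrimitive hlam
  exact ⟨hm (left_mem_Icc.2 pi_pos.le) (Ioo_subset_Icc_self hx) hx.1,
    hm (Ioo_subset_Icc_self hx) (right_mem_Icc.2 pi_pos.le) hx.2⟩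

theorem injOn_sinPowPrimitive (hlam : 0 ≤ lam) : InjOn (sinPowPrimitive lam) (Ioo 0 π) :=
  ((strictMonoOn_sinPowPrimitive hlam).mono Ioo_subset_Icc_self).injOn

theorem surjOn_sinPowPrimitive (hlam : 0 ≤ lam) :
    SurjOn (sinPowPrimitive lam) (Ioo 0 π)
      (Ioo (sinPowPrimitive lam 0) (sinPowPrimitive lam π)) :=
  intermediate_value_Ioo pi_pos.le (continuous_sinPowPrimitive hlam).continuousOn

theorem sinPowPrimitive_zero_exponent (t : ℝ) : sinPowPrimitive 0 t = t - π / 2 := by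
  simp [sinPowPrimitive]

/-- The primitive of `sin ^ lam` has a differentiable inverse on the image of `(0, π)`. -/
theorem exists_inverse_sinPowPrimitive (hlam : 0 ≤ lam) :
    ∃ g : ℝ → ℝ, ∀ y ∈ Ioo (sinPowPrimitive lam 0) (sinPowPrimitive lam π),
      g y ∈ Ioo 0 π ∧ sinPowPrimitive lam (g y) = y ∧
        HasDerivAt g (Real.sin (g y) ^ lam)⁻¹ y := by
  have hs := surjOn_sinPowPrimitive hlam
  have hm := (strictMonoOn_sinPowPrimitive hlam).mono (Ioo_subset_Icc_self (a := 0) (b := π))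
  refine ⟨Function.invFunOn (sinPowPrimitive lam) (Ioo 0 π), ?_⟩
  set g := Function.invFunOn (sinPowPrimitive lam) (Ioo 0 π)
  have hmem : ∀ y ∈ Ioo (sinPowPrimitive lam 0) (sinPowPrimitive lam π), g y ∈ Ioo 0 π :=
    fun y hy => Function.invFunOn_mem (hs hy)
  have heq : ∀ y ∈ Ioo (sinPowPrimitive lam 0) (sinPowPrimitive lam π),
      sinPowPrimitive lam (g y) = y := fun y hy => Function.invFunOn_eq (hs hy)
  have hg : StrictMonoOn g (Ioo (sinPowPrimitive lam 0) (sinPowPrimitive lam π)) := by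
    intro y hy z hz hyz
    rw [← hm.lt_iff_lt (hmem y hy) (hmem z hz), heq y hy, heq z hz]
    exact hyz
  intro y hy
  refine ⟨hmem y hy, heq y hy, ?_⟩
  have himg : Ioo 0 π ⊆ g '' Ioo (sinPowPrimitive lam 0) (sinPowPrimitive lam π) := by
    intro x hx
    have hx' := mapsTo_sinPowPrimitive hlam hx
    exact ⟨_, hx', injOn_sinPowPrimitive hlam (hmem _ hx') hx (heq _ hx')⟩
  have hcont : ContinuousAt g y := hg.continuousAt_of_image_mem_nhds (Ioo_mem_nhds hy.1 hy.2)
    (mem_of_superset (Ioo_mem_nhds (hmem y hy).1 (hmem y hy).2) himg)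
  refine HasDerivAt.of_local_left_inverse hcont (hasDerivAt_sinPowPrimitive hlam (g y))
    (Real.rpow_pos_of_pos (Real.sin_pos_of_mem_Ioo (hmem y hy)) _).ne' ?_
  filter_upwards [Ioo_mem_nhds hy.1 hy.2] with z hz using heq z hz

end Primitive

/-- If the angles of `(0, π)` have sum at least `2 π`, the quadratic form with coefficients
`cot pᵢ` is negative definite on the plane `w₁ + w₂ + w₃ = 0`. -/
theorem cot_form_neg {p₁ p₂ p₃ w₁ w₂ w₃ : ℝ} (h₁ : p₁ ∈ Ioo 0 π) (h₂ : p₂ ∈ Ioo 0 π)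
    (h₃ : p₃ ∈ Ioo 0 π) (hp : 2 * π ≤ p₁ + p₂ + p₃) (hw : w₁ + w₂ + w₃ = 0)
    (hne : ¬(w₁ = 0 ∧ w₂ = 0 ∧ w₃ = 0)) :
    Real.cos p₁ / Real.sin p₁ * w₁ ^ 2 + Real.cos p₂ / Real.sin p₂ * w₂ ^ 2 +
      Real.cos p₃ / Real.sin p₃ * w₃ ^ 2 < 0 := by
  have s₁ := Real.sin_pos_of_mem_Ioo h₁
  have s₂ := Real.sin_pos_of_mem_Ioo h₂
  have s₃ := Real.sin_pos_of_mem_Ioo h₃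
  obtain ⟨l₁, u₁⟩ := h₁
  obtain ⟨l₂, u₂⟩ := h₂
  obtain ⟨l₃, u₃⟩ := h₃
  have hsum : 0 ≤ Real.sin (p₁ + p₂ + p₃) := by
    rw [← Real.sin_sub_two_pi]
    exact Real.sin_nonneg_of_nonneg_of_le_pi (by linarith) (by linarith)
  have hpair : Real.sin (p₁ + p₃) < 0 := by
    rw [← neg_pos, ← Real.sin_sub_pi]
    exact Real.sin_pos_of_pos_of_lt_pi (by linarith) (by linarith)
  rw [Real.sin_add, Real.sin_add, Real.cos_add] at hsum
  rw [Real.sin_add] at hpair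
  set a := Real.cos p₁ / Real.sin p₁ with ha
  set b := Real.cos p₂ / Real.sin p₂ with hb
  set c := Real.cos p₃ / Real.sin p₃ with hc
  have hac : a + c < 0 := by
    have : a + c = (Real.sin p₁ * Real.cos p₃ + Real.cos p₁ * Real.sin p₃) /
        (Real.sin p₁ * Real.sin p₃) := by
      rw [ha, hc]; field_simp; ring
    rw [this]
    exact div_neg_of_neg_of_pos hpair (by positivity)
  have he : 0 < a * b + b * c + a * c := by
    have : a * b + b * c + a * c =
        ((Real.sin p₁ * Real.cos p₂ + Real.cos p₁ * Real.sin p₂) * Real.cos p₃ +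
          (Real.cos p₁ * Real.cos p₂ - Real.sin p₁ * Real.sin p₂) * Real.sin p₃) /
          (Real.sin p₁ * Real.sin p₂ * Real.sin p₃) + 1 := by
      rw [ha, hb, hc]; field_simp; ring
    rw [this]
    positivity
  obtain rfl : w₃ = -(w₁ + w₂) := by linarith
  have hprod : 0 < (a + c) * (a * w₁ ^ 2 + b * w₂ ^ 2 + c * (-(w₁ + w₂)) ^ 2) := by
    have hid : (a + c) * (a * w₁ ^ 2 + b * w₂ ^ 2 + c * (-(w₁ + w₂)) ^ 2) =
        ((a + c) * w₁ + c * w₂) ^ 2 + (a * b + b * c + a * c) * w₂ ^ 2 := by ring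
    rw [hid]
    by_cases hw₂ : w₂ = 0
    · have hw₁ : w₁ ≠ 0 := fun h => hne (by simp [h, hw₂])
      have := mul_ne_zero hac.ne hw₁
      simp only [hw₂, mul_zero, add_zero]
      positivity
    · positivity
  exact neg_of_mul_pos_right hprod hac.le

theorem not_isLocalMax_of_deriv_deriv_pos {f : ℝ → ℝ} {x : ℝ} (h : 0 < deriv (deriv f) x)
    (hc : ContinuousAt f x) : ¬IsLocalMax f x := by
  intro hmax
  have hmin := isLocalMin_of_deriv_deriv_pos h hmax.deriv_eq_zero hc
  have hconst : f =ᶠ[𝓝 x] fun _ => f x := by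
    filter_upwards [hmax, hmin] with y h₁ h₂ using le_antisymm h₁ h₂
  have h0 : deriv (deriv f) x = 0 := by
    rw [hconst.deriv.deriv_eq]; simp
  exact h.ne' h0

/-- The derivatives of a curve in `(0, π)` whose image under the primitive of `sin ^ lam` is
traversed at constant speed. -/
theorem hasDerivAt_deriv_inverse {lam d t : ℝ} {r : ℝ → ℝ}
    (hr : HasDerivAt r (d * (Real.sin (r t) ^ lam)⁻¹) t) (ht : r t ∈ Ioo 0 π) :
    HasDerivAt (fun s => d * (Real.sin (r s) ^ lam)⁻¹)
      (-lam * (Real.cos (r t) / Real.sin (r t) * (d * (Real.sin (r t) ^ lam)⁻¹) ^ 2)) t := by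
  have hs := Real.sin_pos_of_mem_Ioo ht
  have hp := Real.rpow_pos_of_pos hs lam
  have h := ((hr.sin.rpow_const (p := lam) (Or.inl hs.ne')).fun_inv hp.ne').const_mul d
  rw [Real.rpow_sub_one hs.ne'] at h
  refine h.congr_deriv ?_
  field_simp

/-- The region `p₁ + p₂ + p₃ < 2 π` of the cube `(0, π)³` becomes convex after applying the
primitive of `sin ^ lam` to each coordinate. -/
theorem sum_lt_two_pi_of_segment {lam : ℝ} (hlam : 0 ≤ lam) {p q r : Fin 3 → ℝ}
    (hp : ∀ i, p i ∈ Ioo 0 π) (hq : ∀ i, q i ∈ Ioo 0 π) (hr : ∀ i, r i ∈ Ioo 0 π)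
    (hps : p 0 + p 1 + p 2 < 2 * π) (hqs : q 0 + q 1 + q 2 < 2 * π) {a b : ℝ}
    (ha : 0 ≤ a) (hb : 0 ≤ b) (hab : a + b = 1)
    (h : ∀ i, sinPowPrimitive lam (r i) =
      a * sinPowPrimitive lam (p i) + b * sinPowPrimitive lam (q i)) :
    r 0 + r 1 + r 2 < 2 * π := by
  rcases hlam.eq_or_lt with rfl | hpos
  · simp only [sinPowPrimitive_zero_exponent] at h
    obtain rfl : a = 1 - b := by linarith
    have h0 := h 0
    have h1 := h 1
    have h2 := h 2
    have hconv : (1 - b) * (p 0 + p 1 + p 2) + b * (q 0 + q 1 + q 2) < 2 * π :=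
      convex_Iio (𝕜 := ℝ) (2 * π) hps hqs ha hb hab
    linarith
  obtain ⟨g, hg⟩ := exists_inverse_sinPowPrimitive hlam
  set F := sinPowPrimitive lam with hF
  have hgF : ∀ x ∈ Ioo 0 π, g (F x) = x := fun x hx =>
    have hx' := hg _ (mapsTo_sinPowPrimitive hlam hx)
    injOn_sinPowPrimitive hlam hx'.1 hx hx'.2.1
  set d : Fin 3 → ℝ := fun i => F (q i) - F (p i) with hd
  set L : Fin 3 → ℝ → ℝ := fun i t => F (p i) + t * d i with hL
  set R : Fin 3 → ℝ → ℝ := fun i t => g (L i t) with hR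
  have hLmem : ∀ i, ∀ t ∈ Icc (0 : ℝ) 1, L i t ∈ Ioo (F 0) (F π) := by
    intro i t ht
    have hmem := (convex_Ioo (F 0) (F π)) (mapsTo_sinPowPrimitive hlam (hp i))
      (mapsTo_sinPowPrimitive hlam (hq i)) (sub_nonneg.2 ht.2) ht.1 (sub_add_cancel 1 t)
    convert hmem using 1
    simp only [hL, hd, smul_eq_mul, hF]
    ring
  have hRderiv : ∀ i t, L i t ∈ Ioo (F 0) (F π) →
      HasDerivAt (R i) (d i * (Real.sin (R i t) ^ lam)⁻¹) t := by
    intro i t ht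
    have hLd : HasDerivAt (L i) (d i) t := by
      have := ((hasDerivAt_id' t).mul_const (d i)).const_add (F (p i))
      rwa [one_mul] at this
    rw [mul_comm]
    exact (hg _ ht).2.2.comp t hLd
  set φ : ℝ → ℝ := fun t => R 0 t + R 1 t + R 2 t with hφ
  have hφderiv : ∀ t, (∀ i, L i t ∈ Ioo (F 0) (F π)) → HasDerivAt φ
      (d 0 * (Real.sin (R 0 t) ^ lam)⁻¹ + d 1 * (Real.sin (R 1 t) ^ lam)⁻¹ +
        d 2 * (Real.sin (R 2 t) ^ lam)⁻¹) t := fun t ht =>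
    ((hRderiv 0 t (ht 0)).add (hRderiv 1 t (ht 1))).add (hRderiv 2 t (ht 2))
  have hφ0 : φ 0 < 2 * π := by
    simpa [hφ, hR, hL, hgF _ (hp _)] using hps
  have hφ1 : φ 1 < 2 * π := by
    simpa [hφ, hR, hL, hd, hgF _ (hq _)] using hqs
  have hφcont : ContinuousOn φ (Icc 0 1) := fun t ht =>
    (hφderiv t fun i => hLmem i t ht).continuousAt.continuousWithinAt
  obtain ⟨t, ht, hmax⟩ := isCompact_Icc.exists_isMaxOn (nonempty_Icc.2 zero_le_one) hφcont
  suffices hlt : φ t < 2 * π by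
    have hb1 : b ∈ Icc (0 : ℝ) 1 := ⟨hb, by linarith⟩
    have hRr : ∀ i, R i b = r i := by
      intro i
      rw [← hgF _ (hr i), h i]
      obtain rfl : a = 1 - b := by linarith
      simp only [hR, hL, hd]
      ring_nf
    have hle : φ b ≤ φ t := hmax hb1
    rw [← hRr 0, ← hRr 1, ← hRr 2]
    exact hle.trans_lt hlt
  by_contra! hge
  have ht0 : t ≠ 0 := by rintro rfl; linarith
  have ht1 : t ≠ 1 := by rintro rfl; linarith
  have htIoo : t ∈ Ioo (0 : ℝ) 1 := ⟨ht.1.lt_of_ne' ht0, ht.2.lt_of_ne ht1⟩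
  have hnhds : Icc (0 : ℝ) 1 ∈ 𝓝 t := Icc_mem_nhds htIoo.1 htIoo.2
  have hloc : IsLocalMax φ t := hmax.isLocalMax hnhds
  have hLt := fun i => hLmem i t ht
  have hRt : ∀ i, R i t ∈ Ioo 0 π := fun i => (hg _ (hLt i)).1
  have hφt := hφderiv t hLt
  have hcrit := hloc.hasDerivAt_eq_zero hφt
  have hderiv : deriv φ =ᶠ[𝓝 t] fun s =>
      d 0 * (Real.sin (R 0 s) ^ lam)⁻¹ + d 1 * (Real.sin (R 1 s) ^ lam)⁻¹ +
        d 2 * (Real.sin (R 2 s) ^ lam)⁻¹ := by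
    filter_upwards [hnhds] with s hs using (hφderiv s fun i => hLmem i s hs).deriv
  have hsecond := fun i => hasDerivAt_deriv_inverse (hRderiv i t (hLt i)) (hRt i)
  refine not_isLocalMax_of_deriv_deriv_pos ?_ hφt.continuousAt hloc
  rw [hderiv.deriv_eq, (((hsecond 0).fun_add (hsecond 1)).fun_add (hsecond 2)).deriv,
    ← mul_add, ← mul_add]
  refine mul_pos_of_neg_of_neg (neg_neg_of_pos hpos)
    (cot_form_neg (hRt 0) (hRt 1) (hRt 2) hge hcrit ?_)
  rintro ⟨h0, h1, h2⟩
  have hd0 : ∀ i, d i * (Real.sin (R i t) ^ lam)⁻¹ = 0 → d i = 0 := fun i hi =>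
    (mul_eq_zero.1 hi).resolve_right
      (inv_ne_zero (Real.rpow_pos_of_pos (Real.sin_pos_of_mem_Ioo (hRt i)) _).ne')
  have hφeq : φ t = φ 0 := by
    simp [hφ, hR, hL, hd0 0 h0, hd0 1 h1, hd0 2 h2]
  linarith

/-- For `λ ≥ 0` and `h(t) = ∫_{π/2}ᵗ sin(s)^λ ds` on `(0, π)`, the image of the space
`S²(θ,3)` of spherical triangles (parameterized by inner angles) under the componentwise
map `h` is convex. -/
theorem convex_image_spherical_angle_space (lam : ℝ) (hlam : 0 ≤ lam) :
    Convex ℝ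
      ((fun p : ℝ × ℝ × ℝ =>
          (∫ s in (π/2)..p.1, Real.sin s ^ lam,
           ∫ s in (π/2)..p.2.1, Real.sin s ^ lam,
           ∫ s in (π/2)..p.2.2, Real.sin s ^ lam)) ''
        {p : ℝ × ℝ × ℝ | p.2.1 + p.2.2 < π + p.1 ∧ p.1 + p.2.2 < π + p.2.1 ∧
          p.1 + p.2.1 < π + p.2.2 ∧ π < p.1 + p.2.1 + p.2.2}) := by
  rintro _ ⟨⟨p₁, p₂, p₃⟩, ⟨hp₁, hp₂, hp₃, hp₄⟩, rfl⟩ _ ⟨⟨q₁, q₂, q₃⟩, ⟨hq₁, hq₂, hq₃, hq₄⟩, rfl⟩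
    a b ha hb hab
  dsimp only at hp₁ hp₂ hp₃ hp₄ hq₁ hq₂ hq₃ hq₄
  have mp₁ : p₁ ∈ Ioo 0 π := ⟨by linarith, by linarith⟩
  have mp₂ : p₂ ∈ Ioo 0 π := ⟨by linarith, by linarith⟩
  have mp₃ : p₃ ∈ Ioo 0 π := ⟨by linarith, by linarith⟩
  have mq₁ : q₁ ∈ Ioo 0 π := ⟨by linarith, by linarith⟩
  have mq₂ : q₂ ∈ Ioo 0 π := ⟨by linarith, by linarith⟩
  have mq₃ : q₃ ∈ Ioo 0 π := ⟨by linarith, by linarith⟩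
  have hex : ∀ x ∈ Ioo 0 π, ∀ y ∈ Ioo 0 π, ∃ z ∈ Ioo 0 π, sinPowPrimitive lam z =
      a * sinPowPrimitive lam x + b * sinPowPrimitive lam y := fun x hx y hy =>
    surjOn_sinPowPrimitive hlam (convex_Ioo _ _ (mapsTo_sinPowPrimitive hlam hx)
      (mapsTo_sinPowPrimitive hlam hy) ha hb hab)
  obtain ⟨r₁, mr₁, hr₁⟩ := hex p₁ mp₁ q₁ mq₁
  obtain ⟨r₂, mr₂, hr₂⟩ := hex p₂ mp₂ q₂ mq₂
  obtain ⟨r₃, mr₃, hr₃⟩ := hex p₃ mp₃ q₃ mq₃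
  have reflect_mem : ∀ {x : ℝ}, x ∈ Ioo 0 π → π - x ∈ Ioo 0 π := fun hx =>
    ⟨by linarith [hx.2], by linarith [hx.1]⟩
  have reflect_eq : ∀ {x y z : ℝ}, sinPowPrimitive lam z =
      a * sinPowPrimitive lam x + b * sinPowPrimitive lam y →
      sinPowPrimitive lam (π - z) =
        a * sinPowPrimitive lam (π - x) + b * sinPowPrimitive lam (π - y) := by
    intro x y z hz
    simp only [sinPowPrimitive_pi_sub, hz]
    ring
  have key : ∀ {x₁ x₂ x₃ y₁ y₂ y₃ z₁ z₂ z₃ : ℝ},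
      x₁ ∈ Ioo 0 π → x₂ ∈ Ioo 0 π → x₃ ∈ Ioo 0 π → y₁ ∈ Ioo 0 π → y₂ ∈ Ioo 0 π →
      y₃ ∈ Ioo 0 π → z₁ ∈ Ioo 0 π → z₂ ∈ Ioo 0 π → z₃ ∈ Ioo 0 π →
      sinPowPrimitive lam z₁ = a * sinPowPrimitive lam x₁ + b * sinPowPrimitive lam y₁ →
      sinPowPrimitive lam z₂ = a * sinPowPrimitive lam x₂ + b * sinPowPrimitive lam y₂ →
      sinPowPrimitive lam z₃ = a * sinPowPrimitive lam x₃ + b * sinPowPrimitive lam y₃ →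
      x₁ + x₂ + x₃ < 2 * π → y₁ + y₂ + y₃ < 2 * π → z₁ + z₂ + z₃ < 2 * π := by
    intro x₁ x₂ x₃ y₁ y₂ y₃ z₁ z₂ z₃ hx₁ hx₂ hx₃ hy₁ hy₂ hy₃ hz₁ hz₂ hz₃ h₁ h₂ h₃ hx hy
    exact sum_lt_two_pi_of_segment hlam (p := ![x₁, x₂, x₃]) (q := ![y₁, y₂, y₃])
      (r := ![z₁, z₂, z₃]) (Fin.forall_fin_succ.2 ⟨hx₁, Fin.forall_fin_two.2 ⟨hx₂, hx₃⟩⟩)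
      (Fin.forall_fin_succ.2 ⟨hy₁, Fin.forall_fin_two.2 ⟨hy₂, hy₃⟩⟩)
      (Fin.forall_fin_succ.2 ⟨hz₁, Fin.forall_fin_two.2 ⟨hz₂, hz₃⟩⟩) hx hy ha hb hab
      (Fin.forall_fin_succ.2 ⟨h₁, Fin.forall_fin_two.2 ⟨h₂, h₃⟩⟩)
  refine ⟨(r₁, r₂, r₃), ⟨?_, ?_, ?_, ?_⟩, Prod.ext hr₁ (Prod.ext hr₂ hr₃)⟩ <;> dsimp only
  · linarith [key (reflect_mem mp₁) mp₂ mp₃ (reflect_mem mq₁) mq₂ mq₃ (reflect_mem mr₁) mr₂ mr₃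
      (reflect_eq hr₁) hr₂ hr₃ (by linarith) (by linarith)]
  · linarith [key mp₁ (reflect_mem mp₂) mp₃ mq₁ (reflect_mem mq₂) mq₃ mr₁ (reflect_mem mr₂) mr₃
      hr₁ (reflect_eq hr₂) hr₃ (by linarith) (by linarith)]
  · linarith [key mp₁ mp₂ (reflect_mem mp₃) mq₁ mq₂ (reflect_mem mq₃) mr₁ mr₂ (reflect_mem mr₃)
      hr₁ hr₂ (reflect_eq hr₃) (by linarith) (by linarith)]
  · linarith [key (reflect_mem mp₁) (reflect_mem mp₂) (reflect_mem mp₃) (reflect_mem mq₁)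
      (reflect_mem mq₂) (reflect_mem mq₃) (reflect_mem mr₁) (reflect_mem mr₂) (reflect_mem mr₃)
      (reflect_eq hr₁) (reflect_eq hr₂) (reflect_eq hr₃) (by linarith) (by linarith)]
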